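/- Let m+1 be the minimal period length of the continued fraction expansion √(D/Q) = [b₀; {b₁,…,b_m, 2b₀}], and let n+1 be the minimal period length of the continued fraction expansion √(DQ) = [b₀'; {b₁',…,b_n', 2b₀'}]. Let r_k/s_k denote the k-th convergent of √(D/Q) and r_k'/s_k' the k-th convergent of √(DQ), both in lowest terms. Then for every natural number l: r_{l(m+1)−1} = r'_{l(n+1)−1} and s_{l(m+1)−1} = s'_{l(n+1)−1}·Q. -/

import Mathlib

/-- The sequence of complete quotients of `x`: `cq x 0 = x`,
`cq x (j+1) = 1 / (cq x j - ⌊cq x j⌋)`. -/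
noncomputable def cq (x : ℝ) : ℕ → ℝ
  | 0 => x
  | j + 1 => (Int.fract (cq x j))⁻¹

/-- The `j`-th partial quotient of the continued fraction expansion of `x`:
the floor of the `j`-th complete quotient. -/
noncomputable def pq (x : ℝ) (j : ℕ) : ℤ := ⌊cq x j⌋

theorem cq_succ_left (x : ℝ) (k : ℕ) : cq x (k + 1) = cq (Int.fract x)⁻¹ k := by
  induction k with
  | zero => rfl
  | succ k ih => rw [cq, ih, cq]

theorem cq_add (x : ℝ) (a b : ℕ) : cq x (a + b) = cq (cq x a) b := by
  induction b with
  | zero => rfl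
  | succ b ih => rw [← add_assoc, cq, ih, cq]

theorem irrational_inv_fract {x : ℝ} (hx : Irrational x) : Irrational (Int.fract x)⁻¹ := by
  rw [irrational_inv_iff, Int.fract]
  exact hx.sub_intCast _

theorem one_lt_inv_fract {x : ℝ} (hx : Irrational x) : 1 < (Int.fract x)⁻¹ := by
  have h : 0 < Int.fract x := Int.fract_pos.2 (hx.ne_int _)
  exact (one_lt_inv₀ h).2 (Int.fract_lt_one x)

theorem irrational_cq {x : ℝ} (hx : Irrational x) (k : ℕ) : Irrational (cq x k) := by
  induction k with
  | zero => exact hx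
  | succ k ih => exact irrational_inv_fract ih

theorem one_lt_cq {x : ℝ} (hx : Irrational x) (k : ℕ) : 1 < cq x (k + 1) :=
  one_lt_inv_fract (irrational_cq hx k)

theorem convergent_congr {x y : ℝ} (h : ∀ j, pq x j = pq y j) (k : ℕ) :
    x.convergent k = y.convergent k := by
  induction k generalizing x y with
  | zero => simpa [pq, cq] using h 0
  | succ k ih =>
    have h0 : ⌊x⌋ = ⌊y⌋ := h 0
    rw [Real.convergent_succ, Real.convergent_succ, h0, ih]
    intro j
    simpa [pq, cq_succ_left] using h (j + 1)

/-- A real number is determined by its partial quotients. -/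
theorem eq_of_pq_eq {x y : ℝ} (h : ∀ j, pq x j = pq y j) : x = y := by
  have hx := GenContFract.of_convergence x
  have hy := GenContFract.of_convergence y
  have e : (GenContFract.of x).convs = (GenContFract.of y).convs := by
    funext k
    rw [Real.convs_eq_convergent, Real.convs_eq_convergent, convergent_congr h]
  rw [e] at hx
  exact tendsto_nhds_unique hx hy

/-- Numerator and denominator of the `(k-1)`-st convergent of `x`, with `(1, 0)` for `k = 0`. -/
noncomputable def cfPair : ℕ → ℝ → ℤ × ℤ
  | 0, _ => (1, 0)
  | k + 1, x =>
    (⌊x⌋ * (cfPair k (Int.fract x)⁻¹).1 + (cfPair k (Int.fract x)⁻¹).2,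
      (cfPair k (Int.fract x)⁻¹).1)

theorem cfPair_bounds {x : ℝ} (hx : Irrational x) (h1 : 1 < x) (k : ℕ) :
    0 < (cfPair k x).1 ∧ 0 ≤ (cfPair k x).2 ∧
      (cfPair k x).1 ≤ (cfPair (k + 1) x).1 ∧ (cfPair k x).2 ≤ (cfPair (k + 1) x).2 := by
  induction k generalizing x with
  | zero =>
    have : 1 ≤ ⌊x⌋ := Int.le_floor.2 (by exact_mod_cast h1.le)
    simpa [cfPair] using this
  | succ k ih =>
    have hb : 1 ≤ ⌊x⌋ := Int.le_floor.2 (by exact_mod_cast h1.le)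
    obtain ⟨a, b, c, d⟩ := ih (irrational_inv_fract hx) (one_lt_inv_fract hx)
    rw [cfPair, cfPair]
    dsimp only
    refine ⟨by positivity, a.le, ?_, c⟩
    gcongr

theorem cfPair_fst_lt {x : ℝ} (hx : Irrational x) (h1 : 1 < x) (k : ℕ) :
    (cfPair (k + 1) x).1 < (cfPair (k + 2) x).1 := by
  have hb {y : ℝ} (hy : 1 < y) : 1 ≤ ⌊y⌋ := Int.le_floor.2 (by exact_mod_cast hy.le)
  induction k generalizing x with
  | zero =>
    have h2 := hb h1
    have h3 := hb (one_lt_inv_fract hx)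
    simp only [cfPair]
    nlinarith
  | succ k ih =>
    have h2 := hb h1
    have h3 := ih (irrational_inv_fract hx) (one_lt_inv_fract hx)
    have h4 := (cfPair_bounds (irrational_inv_fract hx) (one_lt_inv_fract hx) (k + 1)).2.2.2
    rw [cfPair, cfPair.eq_2 x (k + 2)]
    dsimp only
    nlinarith

theorem cfPair_fst_strictMono {x : ℝ} (hx : Irrational x) (h1 : 1 < x) :
    StrictMono fun k => (cfPair (k + 1) x).1 :=
  strictMono_nat_of_lt_succ (cfPair_fst_lt hx h1)

theorem cfPair_snd_pos {x : ℝ} (hx : Irrational x) (k : ℕ) : 0 < (cfPair (k + 1) x).2 :=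
  (cfPair_bounds (irrational_inv_fract hx) (one_lt_inv_fract hx) k).1

theorem cfPair_det (x : ℝ) (k : ℕ) :
    (cfPair k x).1 * (cfPair (k + 1) x).2 - (cfPair k x).2 * (cfPair (k + 1) x).1
      = (-1) ^ k := by
  induction k generalizing x with
  | zero => simp [cfPair]
  | succ k ih =>
    have h := ih (Int.fract x)⁻¹
    rw [cfPair, cfPair.eq_2 x (k + 1), pow_succ, ← h]
    dsimp only
    ring

theorem isCoprime_cfPair (x : ℝ) (k : ℕ) : IsCoprime (cfPair k x).1 (cfPair k x).2 := by
  have h := cfPair_det x k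
  have hs : ((-1 : ℤ) ^ k) * (-1) ^ k = 1 := by rw [← mul_pow]; simp
  refine ⟨(-1) ^ k * (cfPair (k + 1) x).2, -(-1) ^ k * (cfPair (k + 1) x).1, ?_⟩
  linear_combination ((-1 : ℤ) ^ k) * h + hs

theorem convergent_eq_cfPair {x : ℝ} (hx : Irrational x) (k : ℕ) :
    x.convergent k = ((cfPair (k + 1) x).1 : ℚ) / (cfPair (k + 1) x).2 := by
  induction k generalizing x with
  | zero => simp [cfPair]
  | succ k ih =>
    have h : ((cfPair (k + 1) (Int.fract x)⁻¹).1 : ℚ) ≠ 0 := by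
      exact_mod_cast
        (cfPair_bounds (irrational_inv_fract hx) (one_lt_inv_fract hx) (k + 1)).1.ne'
    rw [Real.convergent_succ, ih (irrational_inv_fract hx), cfPair.eq_2 x (k + 1)]
    push_cast
    rw [inv_div, add_div, mul_div_cancel_right₀ _ h]

/-- The relation between a number and its complete quotients. -/
theorem mul_cq_eq {x : ℝ} (hx : Irrational x) (k : ℕ) :
    x * ((cfPair (k + 1) x).2 * cq x (k + 1) + (cfPair k x).2)
      = (cfPair (k + 1) x).1 * cq x (k + 1) + (cfPair k x).1 := by
  have h0 {y : ℝ} (hy : Irrational y) : y * (Int.fract y)⁻¹ = ⌊y⌋ * (Int.fract y)⁻¹ + 1 := by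
    have h : Int.fract y ≠ 0 := (Int.fract_pos.2 (hy.ne_int _)).ne'
    field_simp
    linarith [Int.floor_add_fract y]
  induction k generalizing x with
  | zero => simpa [cfPair, cq] using h0 hx
  | succ k ih =>
    have h := ih (irrational_inv_fract hx)
    have h1 := h0 hx
    have h2 : (Int.fract x)⁻¹ ≠ 0 := (irrational_inv_fract hx).ne_zero
    rw [cfPair, cfPair.eq_2 x k, cq_succ_left]
    push_cast
    apply mul_left_cancel₀ h2
    linear_combination (((cfPair (k + 1) (Int.fract x)⁻¹).1 : ℝ) * cq (Int.fract x)⁻¹ (k + 1)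
      + (cfPair k (Int.fract x)⁻¹).1) * h1 - h

theorem pq_cq (x : ℝ) (a j : ℕ) : pq (cq x a) j = pq x (a + j) := by
  rw [pq, pq, cq_add]

/-- The partial quotients from index `1` on have period `t` exactly when the `t`-th complete
quotient differs from `x` by an integer. -/
theorem pq_periodic_iff (x : ℝ) (t : ℕ) :
    (∀ j, 1 ≤ j → pq x (j + t) = pq x j) ↔ ∃ c : ℤ, cq x t = x + c := by
  constructor
  · intro h
    have h1 : cq x (t + 1) = cq x 1 := eq_of_pq_eq fun j => by
      rw [pq_cq, pq_cq, ← h (1 + j) (by omega)]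
      congr 1
      omega
    have h2 : Int.fract (cq x t) = Int.fract x := inv_injective h1
    obtain ⟨c, hc⟩ := Int.fract_eq_fract.1 h2
    exact ⟨c, by linarith⟩
  · rintro ⟨c, hc⟩ j hj
    obtain ⟨i, rfl⟩ := Nat.exists_eq_add_of_le' hj
    rw [show i + 1 + t = t + (i + 1) by omega, ← pq_cq, hc]
    simp only [pq, cq_succ_left, Int.fract_add_intCast]

theorem pq_periodic_mul {x : ℝ} {t : ℕ} (h : ∀ j, 1 ≤ j → pq x (j + t) = pq x j) (l j : ℕ)
    (hj : 1 ≤ j) : pq x (j + l * t) = pq x j := by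
  induction l with
  | zero => simp
  | succ l ih => rw [add_mul, one_mul, ← add_assoc, h _ (by omega), ih]

theorem minimal_period_dvd {x : ℝ} {m : ℕ} (hper : ∀ j, 1 ≤ j → pq x (j + m + 1) = pq x j)
    (hmin : ∀ m' < m, ¬ ∀ j, 1 ≤ j → pq x (j + m' + 1) = pq x j) {t : ℕ}
    (ht : ∀ j, 1 ≤ j → pq x (j + t) = pq x j) : m + 1 ∣ t := by
  by_contra hd
  have hpos : 0 < t % (m + 1) := Nat.pos_of_ne_zero fun h => hd (Nat.dvd_of_mod_eq_zero h)
  have hlt : t % (m + 1) < m + 1 := Nat.mod_lt _ (by omega)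
  refine hmin (t % (m + 1) - 1) (by omega) fun j hj => ?_
  rw [show j + (t % (m + 1) - 1) + 1 = j + t % (m + 1) by omega,
    ← pq_periodic_mul (t := m + 1) hper (t / (m + 1)) _ (by omega), ← ht j hj]
  congr 1
  rw [add_assoc, Nat.mod_add_div']

theorem Irrational.eq_zero_of_add_mul_eq_zero {x : ℝ} (hx : Irrational x) {a b : ℤ}
    (h : (a : ℝ) + b * x = 0) : a = 0 ∧ b = 0 := by
  have hb : b = 0 := by
    by_contra hb
    refine ((hx.intCast_mul hb).intCast_add a).ne_int 0 ?_
    simpa using h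
  subst hb
  exact ⟨by simpa using h, rfl⟩

theorem norm_eq_of_cq_eq {x : ℝ} (hx : Irrational x) {D Q : ℕ} (hQ : 0 < Q)
    (hcop : Nat.Coprime D Q) (hxx : (Q : ℝ) * x ^ 2 = D) {k : ℕ} {c : ℤ}
    (hc : cq x (k + 1) = x + c) :
    ∃ s : ℤ, 0 < s ∧ (cfPair (k + 1) x).2 = Q * s ∧
      ((cfPair (k + 1) x).1 ^ 2 - D * Q * s ^ 2 = 1 ∨
        (cfPair (k + 1) x).1 ^ 2 - D * Q * s ^ 2 = -1) := by
  have hm := mul_cq_eq hx k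
  have hdet := cfPair_det x k
  have hqpos := cfPair_snd_pos hx k
  rw [hc] at hm
  generalize cfPair (k + 1) x = P at *
  generalize cfPair k x = P' at *
  obtain ⟨p, q⟩ := P
  obtain ⟨p', q'⟩ := P'
  dsimp only at *
  have hlin : ((q * D - Q * (p * c + p') : ℤ) : ℝ) + ((Q * (q * c + q' - p) : ℤ) : ℝ) * x = 0 := by
    push_cast
    linear_combination (Q : ℝ) * hm - q * hxx
  obtain ⟨h1, h2⟩ := hx.eq_zero_of_add_mul_eq_zero hlin
  have hQ' : (0 : ℤ) < Q := by exact_mod_cast hQ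
  have hp : q * c + q' - p = 0 := (mul_eq_zero.1 h2).resolve_left hQ'.ne'
  have hdvd : (Q : ℤ) ∣ q :=
    (Nat.isCoprime_iff_coprime.2 hcop).symm.dvd_of_dvd_mul_right
      ⟨p * c + p', by linarith⟩
  obtain ⟨s, rfl⟩ := hdvd
  have hs : s * D = p * c + p' :=
    mul_left_cancel₀ hQ'.ne' (by linear_combination h1)
  refine ⟨s, pos_of_mul_pos_right hqpos hQ'.le, rfl, ?_⟩
  have key : p ^ 2 - D * Q * s ^ 2 = -(-1) ^ k := by
    linear_combination -p * hp - Q * s * hs - hdet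
  rcases neg_one_pow_eq_or ℤ k with h | h <;> rw [key, h] <;> simp

theorem cq_eq_of_norm_eq {x : ℝ} (hx : Irrational x) (h1 : 1 < x) {D Q : ℕ}
    (hxx : (Q : ℝ) * x ^ 2 = D) {k : ℕ} {s : ℤ} (hs : (cfPair (k + 1) x).2 = Q * s)
    (h : (cfPair (k + 1) x).1 ^ 2 - D * Q * s ^ 2 = 1 ∨
        (cfPair (k + 1) x).1 ^ 2 - D * Q * s ^ 2 = -1) :
    ∃ c : ℤ, cq x (k + 1) = x + c := by
  have hm := mul_cq_eq hx k
  have hdet := cfPair_det x k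
  have hqpos := cfPair_snd_pos hx k
  have hppos := (cfPair_bounds hx h1 (k + 1)).1
  have hqpos' := (cfPair_bounds hx h1 k).2.1
  have hz := one_lt_cq hx k
  generalize cq x (k + 1) = z at *
  generalize cfPair (k + 1) x = P at *
  generalize cfPair k x = P' at *
  obtain ⟨p, q⟩ := P
  obtain ⟨p', q'⟩ := P'
  dsimp only at *
  subst hs
  obtain ⟨e, he, hn⟩ : ∃ e : ℤ, e ^ 2 = 1 ∧ p ^ 2 - D * Q * s ^ 2 = e := by
    rcases h with h | h
    exacts [⟨1, by norm_num, h⟩, ⟨-1, by norm_num, h⟩]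
  obtain ⟨d, hd, hdet⟩ : ∃ d : ℤ, d ^ 2 = 1 ∧ p' * (Q * s) - q' * p = d :=
    ⟨(-1) ^ k, by rw [← pow_mul, mul_comm, pow_mul]; simp, hdet⟩
  have hnR : (p : ℝ) ^ 2 - D * Q * s ^ 2 = e := by exact_mod_cast hn
  have hdR : (p' : ℝ) * (Q * s) - q' * p = d := by exact_mod_cast hdet
  have heR : (e : ℝ) ^ 2 = 1 := by exact_mod_cast he
  have hqR : (0 : ℝ) < Q * s := by exact_mod_cast hqpos
  have hpR : (0 : ℝ) < p := by exact_mod_cast hppos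
  have hqR' : (0 : ℝ) ≤ q' := by exact_mod_cast hqpos'
  push_cast at hm
  have e1 : (x * (Q * s) - p) * (x * (Q * s) + p) = -e := by
    linear_combination Q * (s : ℝ) ^ 2 * hxx - hnR
  have e2 : (x * (Q * s) - p) * (Q * s * z + q') = d := by
    linear_combination (Q * s : ℝ) * hm + hdR
  have hde : d = -e := by
    have h3 : (d - e) * (d + e) = 0 := by linear_combination hd - he
    rcases mul_eq_zero.1 h3 with h4 | h4
    · exfalso
      have h5 : (d : ℝ) = e := by exact_mod_cast sub_eq_zero.1 h4
      have h6 : 0 < (x * (Q * s) + p) * (Q * s * z + q') := by positivity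
      have h7 : (x * (Q * s) - p) ^ 2 * ((x * (Q * s) + p) * (Q * s * z + q')) = -1 := by
        linear_combination (x * (Q * s) - p) * (Q * s * z + q') * e1 - e * e2 - e * h5 - heR
      nlinarith [mul_nonneg (sq_nonneg (x * (Q * s) - p)) h6.le]
    · linarith
  refine ⟨e * (D * s * q' - p * p'), ?_⟩
  have hdeR : (d : ℝ) = -e := by exact_mod_cast hde
  push_cast
  linear_combination (-z + x) * heR - e * x * hdeR - e * x * hdR + e * z * e1
    - e * (x * (Q * s) + p) * hm + e * s * q' * hxx

/-- A solution of `p ^ 2 - D * Q * s ^ 2 = ± 1` gives the convergent `p / (Q * s)`. -/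
theorem exists_cfPair_eq {x : ℝ} (hx : Irrational x) (h1 : 1 < x) {D Q : ℕ} (hQ : 0 < Q)
    (hQD : Q < D) (hxx : (Q : ℝ) * x ^ 2 = D) {p s : ℤ} (hp : 0 < p) (hs : 0 < s)
    (h : p ^ 2 - D * Q * s ^ 2 = 1 ∨ p ^ 2 - D * Q * s ^ 2 = -1) :
    ∃ k, cfPair (k + 1) x = (p, Q * s) := by
  have hQZ : (0 : ℤ) < Q := by exact_mod_cast hQ
  have hDZ : (Q : ℤ) + 1 ≤ D := by exact_mod_cast hQD
  have hqpos : 0 < Q * s := by positivity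
  have hle : Q * s ≤ p := by
    have h2 : (Q * s) ^ 2 ≤ p ^ 2 := by
      have h3 : (Q + 1) * (Q * s ^ 2) ≤ D * (Q * s ^ 2) := by gcongr
      have h4 : 1 ≤ Q * s ^ 2 := by
        have : 0 < Q * s ^ 2 := by positivity
        omega
      rcases h with h | h <;> nlinarith
    exact le_of_sq_le_sq h2 hp.le
  have hcop : IsCoprime p (Q * s) := by
    rcases h with h | h
    · exact ⟨p, -(D * s), by linear_combination h⟩
    · exact ⟨-p, D * s, by linear_combination -h⟩
  have hnat : Nat.Coprime p.natAbs (Q * s).natAbs := Int.isCoprime_iff_gcd_eq_one.1 hcop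
  have hden : ((((p : ℚ) / ((Q * s : ℤ) : ℚ)).den : ℤ)) = Q * s :=
    Rat.den_div_eq_of_coprime hqpos hnat
  have hnum : ((p : ℚ) / ((Q * s : ℤ) : ℚ)).num = p :=
    Rat.num_div_eq_of_coprime hqpos hnat
  have hqR : (0 : ℝ) < Q * s := by exact_mod_cast hqpos
  have hpR : (0 : ℝ) < p := by exact_mod_cast hp
  have hleR : (Q * s : ℝ) ≤ p := by exact_mod_cast hle
  have habs : |x * (Q * s) - p| * (x * (Q * s) + p) = 1 := by
    rw [← abs_of_pos (show 0 < x * (Q * s) + p by positivity), ← abs_mul]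
    have e1 : (x * (Q * s) - p) * (x * (Q * s) + p)
        = -((p ^ 2 - D * Q * s ^ 2 : ℤ) : ℝ) := by
      push_cast
      linear_combination Q * (s : ℝ) ^ 2 * hxx
    rw [e1]
    rcases h with h | h <;> rw [h] <;> simp
  have hlt : |x - ((p : ℚ) / ((Q * s : ℤ) : ℚ) : ℚ)|
      < 1 / (2 * (((p : ℚ) / ((Q * s : ℤ) : ℚ)).den : ℝ) ^ 2) := by
    have hdenR : ((((p : ℚ) / ((Q * s : ℤ) : ℚ)).den : ℝ)) = Q * s := by exact_mod_cast hden
    rw [hdenR]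
    push_cast
    have e2 : x - p / (Q * s) = (x * (Q * s) - p) / (Q * s) := by field_simp
    rw [e2, abs_div, abs_of_pos hqR, div_lt_div_iff₀ hqR (by positivity)]
    have h5 : 2 * (Q * s : ℝ) < x * (Q * s) + p := by nlinarith
    have h6 : 0 < |x * (Q * s) - p| := by
      by_contra! h7
      have h8 : 0 < x * (Q * s) + p := by positivity
      nlinarith
    have h9 : |x * (Q * s) - p| * (2 * (Q * s)) < 1 := by
      rw [← habs]
      gcongr
    nlinarith
  obtain ⟨k, hk⟩ := Real.exists_rat_eq_convergent hlt
  refine ⟨k, ?_⟩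
  have hk' := hk.trans (convergent_eq_cfPair hx k)
  have hcop' : Nat.Coprime (cfPair (k + 1) x).1.natAbs (cfPair (k + 1) x).2.natAbs :=
    Int.isCoprime_iff_gcd_eq_one.1 (isCoprime_cfPair x (k + 1))
  have hpos' := cfPair_snd_pos hx k
  ext
  · exact (Rat.num_div_eq_of_coprime hpos' hcop').symm.trans (hk' ▸ hnum)
  · exact (Rat.den_div_eq_of_coprime hpos' hcop').symm.trans (hk' ▸ hden)

/-- The numerators of the convergents ending a period are the `p > 0` for which
`p ^ 2 - D * Q * s ^ 2 = ± 1` is solvable. -/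
theorem range_cfPair_period {x : ℝ} (hx : Irrational x) (h1 : 1 < x) {D Q : ℕ} (hQ : 0 < Q)
    (hQD : Q < D) (hcop : Nat.Coprime D Q) (hxx : (Q : ℝ) * x ^ 2 = D) {m : ℕ}
    (hper : ∀ j, 1 ≤ j → pq x (j + m + 1) = pq x j)
    (hmin : ∀ m' < m, ¬ ∀ j, 1 ≤ j → pq x (j + m' + 1) = pq x j) :
    Set.range (fun l : ℕ => (cfPair ((l + 1) * (m + 1)) x).1)
      = {p : ℤ | 0 < p ∧ ∃ s : ℤ, 0 < s ∧
          (p ^ 2 - D * Q * s ^ 2 = 1 ∨ p ^ 2 - D * Q * s ^ 2 = -1)} := by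
  ext p
  constructor
  · rintro ⟨l, rfl⟩
    obtain ⟨c, hc⟩ := (pq_periodic_iff x _).1 (pq_periodic_mul (t := m + 1) hper (l + 1))
    obtain ⟨k, hk⟩ : ∃ k, (l + 1) * (m + 1) = k + 1 :=
      Nat.exists_eq_add_of_le' (Nat.mul_pos l.succ_pos m.succ_pos)
    rw [hk] at hc
    obtain ⟨s, hs, -, h⟩ := norm_eq_of_cq_eq hx hQ hcop hxx hc
    dsimp only
    rw [hk]
    exact ⟨(cfPair_bounds hx h1 _).1, s, hs, h⟩
  · rintro ⟨hp, s, hs, h⟩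
    obtain ⟨k, hk⟩ := exists_cfPair_eq hx h1 hQ hQD hxx hp hs h
    have hc := cq_eq_of_norm_eq hx h1 hxx (k := k) (s := s) (by rw [hk]) (by rwa [hk])
    obtain ⟨l, hl⟩ := minimal_period_dvd hper hmin ((pq_periodic_iff x _).2 hc)
    cases l with
    | zero => simp at hl
    | succ l =>
      refine ⟨l, ?_⟩
      dsimp only
      rw [mul_comm, ← hl, hk]

theorem cfPair_period_strictMono {x : ℝ} (hx : Irrational x) (h1 : 1 < x) (m : ℕ) :
    StrictMono (fun l : ℕ => (cfPair ((l + 1) * (m + 1)) x).1) := by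
  intro a b hab
  have h2 : (a + 1) * (m + 1) < (b + 1) * (m + 1) := by gcongr
  obtain ⟨k, hk⟩ : ∃ k, (a + 1) * (m + 1) = k + 1 :=
    Nat.exists_eq_add_of_le' (Nat.mul_pos a.succ_pos m.succ_pos)
  obtain ⟨k', hk'⟩ : ∃ k, (b + 1) * (m + 1) = k + 1 :=
    Nat.exists_eq_add_of_le' (Nat.mul_pos b.succ_pos m.succ_pos)
  dsimp only
  rw [hk, hk']
  exact cfPair_fst_strictMono hx h1 (by omega)

theorem cfPair_eq_of_convs_eq {x : ℝ} (hx : Irrational x) {t : ℕ} (ht : 0 < t) {r s : ℕ}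
    (hs : 0 < s) (hrs : Nat.Coprime r s)
    (h : (GenContFract.of x).convs (t - 1) = (r : ℝ) / s) : cfPair t x = ((r : ℤ), (s : ℤ)) := by
  obtain ⟨k, rfl⟩ := Nat.exists_eq_add_of_le' ht
  rw [Nat.add_sub_cancel, Real.convs_eq_convergent, convergent_eq_cfPair hx] at h
  have h' : ((cfPair (k + 1) x).1 : ℚ) / (cfPair (k + 1) x).2 = ((r : ℤ) : ℚ) / ((s : ℤ) : ℚ) := by
    rw [← Rat.cast_inj (α := ℝ)]
    simpa using h
  have hrs' : Nat.Coprime (r : ℤ).natAbs (s : ℤ).natAbs := by simpa using hrs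
  have hcop : Nat.Coprime (cfPair (k + 1) x).1.natAbs (cfPair (k + 1) x).2.natAbs :=
    Int.isCoprime_iff_gcd_eq_one.1 (isCoprime_cfPair x (k + 1))
  have hpos := cfPair_snd_pos hx k
  have hs' : (0 : ℤ) < s := by exact_mod_cast hs
  ext
  · rw [← Rat.num_div_eq_of_coprime hpos hcop, h', Rat.num_div_eq_of_coprime hs' hrs']
  · rw [← Rat.den_div_eq_of_coprime hpos hcop, h', Rat.den_div_eq_of_coprime hs' hrs']

theorem eq_of_norm_eq {N p u v : ℤ} (hN : 1 < N) (hu : 0 < u) (hv : 0 < v)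
    (hnu : p ^ 2 - N * u ^ 2 = 1 ∨ p ^ 2 - N * u ^ 2 = -1)
    (hnv : p ^ 2 - N * v ^ 2 = 1 ∨ p ^ 2 - N * v ^ 2 = -1) : u = v := by
  wlog h : u ≤ v generalizing u v
  · exact (this hv hu hnv hnu (by omega)).symm
  refine h.eq_of_not_lt fun h => ?_
  have h2 : 3 ≤ v ^ 2 - u ^ 2 := by nlinarith
  have h3 : N * (v ^ 2 - u ^ 2) ≤ 2 := by
    rw [mul_sub]
    omega
  nlinarith

/-- Let `m+1` be the minimal period length of `√(D/Q) = [b₀; {b₁,…,b_m, 2b₀}]` and `n+1`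
the minimal period length of `√(DQ) = [b₀'; {b₁',…,b_n', 2b₀'}]`. Let `r_k/s_k` be the
`k`-th convergent of `√(D/Q)` and `r_k'/s_k'` the `k`-th convergent of `√(DQ)`, both
in lowest terms. Then for every `l ≥ 1`:
`r_{l(m+1)−1} = r'_{l(n+1)−1}` and `s_{l(m+1)−1} = s'_{l(n+1)−1}·Q`. -/
theorem stmt_10 (D Q : ℕ) (hD : 0 < D) (hQ : 0 < Q) (hQD : Q < D)
    (hcop : Nat.Coprime D Q)
    (hns : ¬ ∃ a : ℚ, a ^ 2 = (D : ℚ) / Q)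
    (m : ℕ)
    (hxper : ∀ j : ℕ, 1 ≤ j →
      pq (Real.sqrt ((D : ℝ) / (Q : ℝ))) (j + m + 1) = pq (Real.sqrt ((D : ℝ) / (Q : ℝ))) j)
    (hxper0 : pq (Real.sqrt ((D : ℝ) / (Q : ℝ))) (m + 1)
      = 2 * pq (Real.sqrt ((D : ℝ) / (Q : ℝ))) 0)
    (hxmin : ∀ m' : ℕ, m' < m → ¬ (∀ j : ℕ, 1 ≤ j →
      pq (Real.sqrt ((D : ℝ) / (Q : ℝ))) (j + m' + 1) = pq (Real.sqrt ((D : ℝ) / (Q : ℝ))) j))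
    (n : ℕ)
    (hyper : ∀ j : ℕ, 1 ≤ j →
      pq (Real.sqrt ((D : ℝ) * (Q : ℝ))) (j + n + 1) = pq (Real.sqrt ((D : ℝ) * (Q : ℝ))) j)
    (hyper0 : pq (Real.sqrt ((D : ℝ) * (Q : ℝ))) (n + 1)
      = 2 * pq (Real.sqrt ((D : ℝ) * (Q : ℝ))) 0)
    (hymin : ∀ n' : ℕ, n' < n → ¬ (∀ j : ℕ, 1 ≤ j →
      pq (Real.sqrt ((D : ℝ) * (Q : ℝ))) (j + n' + 1) = pq (Real.sqrt ((D : ℝ) * (Q : ℝ))) j)) :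
    ∀ l : ℕ, 0 < l → ∀ r s r' s' : ℕ,
      0 < r → 0 < s → Nat.Coprime r s →
      (GenContFract.of (Real.sqrt ((D : ℝ) / (Q : ℝ)))).convs (l * (m + 1) - 1)
        = (r : ℝ) / (s : ℝ) →
      0 < r' → 0 < s' → Nat.Coprime r' s' →
      (GenContFract.of (Real.sqrt ((D : ℝ) * (Q : ℝ)))).convs (l * (n + 1) - 1)
        = (r' : ℝ) / (s' : ℝ) →
      r = r' ∧ s = s' * Q := by
  have hQR : (0 : ℝ) < Q := by exact_mod_cast hQ
  have hDQ : (Q : ℝ) < D := by exact_mod_cast hQD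
  have hQ1 : (1 : ℝ) ≤ Q := by exact_mod_cast hQ
  set x := Real.sqrt ((D : ℝ) / (Q : ℝ)) with hxdef
  set y := Real.sqrt ((D : ℝ) * (Q : ℝ)) with hydef
  have hx2 : x ^ 2 = D / Q := Real.sq_sqrt (by positivity)
  have hy2 : y ^ 2 = D * Q := Real.sq_sqrt (by positivity)
  have hyx : y = x * Q := by
    rw [hydef, hxdef, Real.sqrt_eq_iff_mul_self_eq (by positivity) (by positivity)]
    rw [mul_mul_mul_comm, Real.mul_self_sqrt (by positivity)]
    field_simp
  have hx : Irrational x := by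
    rintro ⟨a, ha⟩
    refine hns ⟨a, ?_⟩
    rw [← ha] at hx2
    rw [← Rat.cast_inj (α := ℝ)]
    simpa using hx2
  have hy : Irrational y := by
    rw [hyx]
    exact hx.mul_natCast hQ.ne'
  have hx1 : 1 < x := Real.lt_sqrt_of_sq_lt (by rw [one_pow]; exact (one_lt_div hQR).2 hDQ)
  have hy1 : 1 < y := by rw [hyx]; nlinarith
  have hxx : (Q : ℝ) * x ^ 2 = D := by rw [hx2]; field_simp
  have hyy : ((1 : ℕ) : ℝ) * y ^ 2 = ((D * Q : ℕ) : ℝ) := by rw [hy2]; push_cast; ring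
  have hDQ1 : 1 < D * Q := by nlinarith
  intro l hl r s r' s' _ hs hrs hconv _ hs' hrs' hconv'
  obtain ⟨l, rfl⟩ := Nat.exists_eq_add_of_le' hl
  have hr := cfPair_eq_of_convs_eq hx (Nat.mul_pos hl m.succ_pos) hs hrs hconv
  have hr' := cfPair_eq_of_convs_eq hy (Nat.mul_pos hl n.succ_pos) hs' hrs' hconv'
  have hrange : Set.range (fun l : ℕ => (cfPair ((l + 1) * (m + 1)) x).1)
      = Set.range (fun l : ℕ => (cfPair ((l + 1) * (n + 1)) y).1) := by
    rw [range_cfPair_period hx hx1 hQ hQD hcop hxx hxper hxmin,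
      range_cfPair_period hy hy1 one_pos hDQ1 (Nat.coprime_one_right _) hyy hyper hymin]
    simp
  have hfun := congrFun ((StrictMono.range_inj (cfPair_period_strictMono hx hx1 m)
    (cfPair_period_strictMono hy hy1 n)).1 hrange) l
  have hrr : r = r' := by
    simpa [hr, hr'] using hfun
  refine ⟨hrr, ?_⟩
  subst hrr
  obtain ⟨c, hc⟩ := (pq_periodic_iff x _).1 (pq_periodic_mul (t := m + 1) hxper (l + 1))
  obtain ⟨c', hc'⟩ := (pq_periodic_iff y _).1 (pq_periodic_mul (t := n + 1) hyper (l + 1))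
  obtain ⟨k, hk⟩ := Nat.exists_eq_add_of_le' (Nat.mul_pos hl m.succ_pos)
  obtain ⟨k', hk'⟩ := Nat.exists_eq_add_of_le' (Nat.mul_pos hl n.succ_pos)
  simp only [Nat.succ_eq_add_one, zero_add] at hk hk'
  rw [hk] at hc hr
  rw [hk'] at hc' hr'
  obtain ⟨u, hu, hsu, hnu⟩ := norm_eq_of_cq_eq hx hQ hcop hxx hc
  obtain ⟨v, hv, hsv, hnv⟩ := norm_eq_of_cq_eq hy one_pos (Nat.coprime_one_right _) hyy hc'
  rw [hr] at hsu hnu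
  rw [hr'] at hsv hnv
  push_cast at hsu hsv hnu hnv
  have hDQZ : (1 : ℤ) < D * Q := by exact_mod_cast hDQ1
  rw [mul_one] at hnv
  have huv : u = v := eq_of_norm_eq hDQZ hu hv hnu hnv
  have : (s : ℤ) = s' * Q := by rw [hsu, hsv, huv]; ring
  exact_mod_cast this
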